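/- Let m, r be positive integers, N ≥ 0, n = 2m, and let ρ denote the staircase partition (r, r−1, …, 2, 1). Work in the field of rational functions over ℚ in indeterminates a₁,…,a_n, y₁,…,y_N, x₁,…,x_n. Then Pf( ((a_i − a_j)/(x_i + x_j)) · s_ρ(y₁,…,y_N, x_i, x_j) ) = ( s_ρ(y₁,…,y_N) )^{m−1} · s_ρ(y₁,…,y_N, x₁,…,x_n) · Pf( (a_i − a_j)/(x_i + x_j) ), where each Pf is the Pfaffian of the antisymmetric n × n matrix with the indicated (i,j) entry. -/

import Mathlib

open Finset

/-- The Pfaffian of a `2m × 2m` matrix: the sum over all permutations `σ` with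
`σ(2i-1) < σ(2i)` for each `i` and `σ(1) < σ(3) < ⋯ < σ(2m-1)` (1-indexed). -/
def pfaffian {R : Type*} [CommRing R] (m : ℕ) (M : Matrix (Fin (2 * m)) (Fin (2 * m)) R) : R :=
  ∑ σ : Equiv.Perm (Fin (2 * m)),
    if (∀ i : Fin m, σ ⟨2 * i.val, by omega⟩ < σ ⟨2 * i.val + 1, by omega⟩) ∧
       (∀ i j : Fin m, i < j → σ ⟨2 * i.val, by omega⟩ < σ ⟨2 * j.val, by omega⟩)
    then ((Equiv.Perm.sign σ : ℤ) : R) *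
      ∏ i : Fin m, M (σ ⟨2 * i.val, by omega⟩) (σ ⟨2 * i.val + 1, by omega⟩)
    else 0

/-- The Schur polynomial for a weakly increasing index vector `μ` of length `p`,
as `det(tᵢ^{μⱼ + j - 1}) / det(tᵢ^{j-1})` (0-indexed: `det(tᵢ^{μⱼ + j}) / det(tᵢ^j)`). -/
noncomputable def schur {K : Type*} [Field K] {p : ℕ} (μ : Fin p → ℕ) (t : Fin p → K) : K :=
  Matrix.det (Matrix.of fun i j : Fin p => t i ^ (μ j + (j : ℕ))) /
    Matrix.det (Matrix.of fun i j : Fin p => t i ^ (j : ℕ))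

/-- Pad a partition `v₁ ≥ v₂ ≥ … ≥ v_l` with zeros to length `p ≥ l` and rearrange
weakly increasingly. -/
def padIncr (l p : ℕ) (v : Fin l → ℕ) : Fin p → ℕ :=
  fun j => if h : p - 1 - (j : ℕ) < l then v ⟨p - 1 - (j : ℕ), h⟩ else 0

/-- The staircase partition `ρ = (r, r-1, …, 2, 1)`. -/
def staircase (r : ℕ) : Fin r → ℕ := fun i => r - (i : ℕ)

/-- The field of rational functions over `ℚ` in `a₁,…,a_n, y₁,…,y_N, x₁,…,x_n`. -/
abbrev RatFunc15 (N n : ℕ) : Type := FractionRing (MvPolynomial (Fin n ⊕ Fin N ⊕ Fin n) ℚ)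

noncomputable def A15 (N n : ℕ) (i : Fin n) : RatFunc15 N n :=
  algebraMap (MvPolynomial (Fin n ⊕ Fin N ⊕ Fin n) ℚ) _ (MvPolynomial.X (Sum.inl i))

noncomputable def Y15 (N n : ℕ) (i : Fin N) : RatFunc15 N n :=
  algebraMap (MvPolynomial (Fin n ⊕ Fin N ⊕ Fin n) ℚ) _ (MvPolynomial.X (Sum.inr (Sum.inl i)))

noncomputable def X15 (N n : ℕ) (i : Fin n) : RatFunc15 N n :=
  algebraMap (MvPolynomial (Fin n ⊕ Fin N ⊕ Fin n) ℚ) _ (MvPolynomial.X (Sum.inr (Sum.inr i)))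

theorem det_fromBlocks_diagonal_top_of_ne_zero {R ι : Type*} [CommRing R] [IsDomain R]
    [Fintype ι] [DecidableEq ι] (u w : ι → R) (hu : ∀ i, u i ≠ 0) (C D : Matrix ι ι R) :
    (Matrix.fromBlocks (Matrix.diagonal u) (Matrix.diagonal w) C D).det =
      (D * Matrix.diagonal u - C * Matrix.diagonal w).det := by
  have hU : (Matrix.diagonal u).det ≠ 0 := by
    rw [Matrix.det_diagonal]
    exact prod_ne_zero_iff.2 fun i _ => hu i
  have hmul : Matrix.fromBlocks (Matrix.diagonal u) (Matrix.diagonal w) C D *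
      Matrix.fromBlocks 1 (-Matrix.diagonal w) 0 (Matrix.diagonal u) =
      Matrix.fromBlocks (Matrix.diagonal u) 0 C
        (D * Matrix.diagonal u - C * Matrix.diagonal w) := by
    rw [Matrix.fromBlocks_multiply]
    congr 1
    · simp
    · simp [mul_comm]
    · simp
    · rw [Matrix.mul_neg]; abel
  have h := congrArg Matrix.det hmul
  rw [Matrix.det_mul, Matrix.det_fromBlocks_zero₂₁, Matrix.det_fromBlocks_zero₁₂,
    Matrix.det_one, one_mul, mul_comm] at h
  exact mul_left_cancel₀ hU h

theorem det_fromBlocks_diagonal_top {K ι : Type*} [Field K] [Fintype ι] [DecidableEq ι]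
    (u w : ι → K) (C D : Matrix ι ι K) :
    (Matrix.fromBlocks (Matrix.diagonal u) (Matrix.diagonal w) C D).det =
      (D * Matrix.diagonal u - C * Matrix.diagonal w).det := by
  have h := det_fromBlocks_diagonal_top_of_ne_zero
    (fun i => Polynomial.X + Polynomial.C (u i)) (fun i => Polynomial.C (w i))
    (fun i => Polynomial.X_add_C_ne_zero (u i)) (C.map Polynomial.C) (D.map Polynomial.C)
  have h0 := congrArg (Polynomial.evalRingHom (0 : K)) h
  have hC : ∀ M : Matrix ι ι K, (M.map Polynomial.C).map (Polynomial.evalRingHom (0 : K)) = M :=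
    fun M => by ext; simp
  have hd : ∀ f : ι → Polynomial K, (Matrix.diagonal f).map (Polynomial.evalRingHom (0 : K)) =
      Matrix.diagonal fun i => (f i).eval 0 := fun f => by
    rw [Matrix.diagonal_map (map_zero _)]; rfl
  rw [RingHom.map_det, RingHom.map_det, RingHom.mapMatrix_apply, RingHom.mapMatrix_apply,
    Matrix.fromBlocks_map, Matrix.map_sub _ (map_sub _), Matrix.map_mul, Matrix.map_mul,
    hC, hC, hd, hd] at h0
  simpa using h0

/-- The square matrix with rows `(u i * q i ^ l)ₗ, (v i * q i ^ l)ₗ`, over two families of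
points of the same size. -/
def pairVandermonde {K ι : Type*} [Field K] (m : ℕ) (q u v : ι → K) :
    Matrix ι (Fin m ⊕ Fin m) K :=
  Matrix.of fun i => Sum.elim (fun l => u i * q i ^ (l : ℕ)) (fun l => v i * q i ^ (l : ℕ))

/-- Determinants of generalized Loewner matrices: the proportionality factor to the
corresponding double Vandermonde determinant only depends on the nodes. -/
theorem exists_det_loewner_mul_eq {K : Type*} [Field K] {m : ℕ} (q : Fin m ⊕ Fin m → K)
    (hq : Function.Injective q) :
    ∃ κ : K, ∀ u v : Fin m ⊕ Fin m → K,
      (Matrix.of fun i j : Fin m =>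
        (u (.inl i) * v (.inr j) - v (.inl i) * u (.inr j)) /
          (q (.inr j) - q (.inl i))).det * κ = (pairVandermonde m q u v).det := by
  classical
  set x : Fin m → K := fun i => q (.inl i) with hx
  set z : Fin m → K := fun i => q (.inr i) with hz
  have hxinj : Function.Injective x := fun i j h => Sum.inl_injective (hq h)
  have hzx : ∀ i j, z j ≠ x i := fun i j h => by simpa using hq h
  set V := Matrix.vandermonde x
  set Lz : Fin m → K := fun j => (Lagrange.nodal univ x).eval (z j)
  set w : Fin m → K := fun i => Lagrange.nodalWeight univ x i
  refine ⟨(∏ j, Lz j) * (∏ i, w i) * V.det ^ 2, fun u v => ?_⟩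
  set B : Matrix (Fin m) (Fin m) K :=
    Matrix.of fun j i => (Lagrange.basis univ x i).eval (z j) with hB
  have hBV : ∀ j (l : Fin m), ∑ i, B j i * x i ^ (l : ℕ) = z j ^ (l : ℕ) := by
    intro j l
    have h := Lagrange.eq_interpolate_of_eval_eq (s := univ) (v := x)
      (f := (Polynomial.X : Polynomial K) ^ (l : ℕ)) (r := fun i => x i ^ (l : ℕ))
      hxinj.injOn (by simp) (by simp)
    have h' := congrArg (Polynomial.eval (z j)) h
    rw [Lagrange.interpolate_apply, Polynomial.eval_finsetSum] at h'
    simp only [Polynomial.eval_pow, Polynomial.eval_X, Polynomial.eval_mul,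
      Polynomial.eval_C] at h'
    rw [h']
    exact sum_congr rfl fun i _ => mul_comm _ _
  have hfac : pairVandermonde m q u v =
      Matrix.fromBlocks (Matrix.diagonal fun i => u (.inl i)) (Matrix.diagonal fun i => v (.inl i))
        (Matrix.diagonal (fun j => u (.inr j)) * B) (Matrix.diagonal (fun j => v (.inr j)) * B) *
      Matrix.fromBlocks V 0 0 V := by
    rw [Matrix.fromBlocks_multiply]
    ext (i | i) (l | l)
    · simp [pairVandermonde, V, Matrix.vandermonde_apply, hx]
    · simp [pairVandermonde, V, Matrix.vandermonde_apply, hx]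
    · simp only [pairVandermonde, Matrix.of_apply, Sum.elim_inl, Matrix.fromBlocks_apply₂₁,
        Matrix.mul_zero, add_zero, Matrix.mul_assoc, Matrix.diagonal_mul]
      rw [Matrix.mul_apply]
      simp only [V, Matrix.vandermonde_apply, hBV, hz]
    · simp only [pairVandermonde, Matrix.of_apply, Sum.elim_inr, Matrix.fromBlocks_apply₂₂,
        Matrix.mul_zero, zero_add, Matrix.mul_assoc, Matrix.diagonal_mul]
      rw [Matrix.mul_apply]
      simp only [V, Matrix.vandermonde_apply, hBV, hz]
  have hcore : Matrix.diagonal (fun j => v (.inr j)) * B * Matrix.diagonal (fun i => u (.inl i)) -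
      Matrix.diagonal (fun j => u (.inr j)) * B * Matrix.diagonal (fun i => v (.inl i)) =
      Matrix.diagonal Lz * (Matrix.of fun i j : Fin m =>
        (u (.inl i) * v (.inr j) - v (.inl i) * u (.inr j)) /
          (q (.inr j) - q (.inl i))).transpose * Matrix.diagonal w := by
    ext j i
    simp only [Matrix.sub_apply, Matrix.mul_diagonal, Matrix.diagonal_mul,
      Matrix.transpose_apply, Matrix.of_apply, hB]
    rw [Lagrange.eval_basis_not_at_node (mem_univ i) (hzx i j)]
    simp only [Lz, w, hx, hz]
    ring
  rw [hfac, Matrix.det_mul, det_fromBlocks_diagonal_top, hcore, Matrix.det_fromBlocks_zero₂₁,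
    Matrix.det_mul, Matrix.det_mul, Matrix.det_transpose, Matrix.det_diagonal,
    Matrix.det_diagonal]
  ring

/-- Pairing of `Fin (2 * m)` into consecutive couples `(2 * k, 2 * k + 1)`. -/
def pairEquiv (m : ℕ) : Fin m × Bool ≃ Fin (2 * m) where
  toFun p := ⟨2 * p.1 + p.2.toNat, by have := p.2.toNat_le; omega⟩
  invFun i := (⟨i / 2, by omega⟩, decide ((i : ℕ) % 2 = 1))
  left_inv := by
    rintro ⟨k, _ | _⟩ <;> ext <;> simp; omega
  right_inv i := by
    ext
    rcases Nat.mod_two_eq_zero_or_one i with h | h <;> simp [h] <;> omega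

/-- Reordering of couples by `h.1`, after reordering within each couple by `h.2`. -/
def couplePerm {m : ℕ} (h : Equiv.Perm (Fin m) × (Fin m → Equiv.Perm Bool)) :
    Equiv.Perm (Fin m × Bool) :=
  Equiv.prodCongrLeft (fun _ => h.1) * Equiv.prodCongrRight h.2

theorem couplePerm_apply {m : ℕ} (h : Equiv.Perm (Fin m) × (Fin m → Equiv.Perm Bool))
    (p : Fin m × Bool) : couplePerm h p = (h.1 p.1, h.2 p.1 p.2) := rfl

theorem sign_couplePerm {m : ℕ} (h : Equiv.Perm (Fin m) × (Fin m → Equiv.Perm Bool)) :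
    Equiv.Perm.sign (couplePerm h) = ∏ k, Equiv.Perm.sign (h.2 k) := by
  rw [couplePerm, Equiv.Perm.sign_mul, Equiv.Perm.sign_prodCongrLeft,
    Equiv.Perm.sign_prodCongrRight]
  simp

/-- The couples `(g (k, false), g (k, true))` are increasing, as are their first entries. -/
def IsSortedPairing {m : ℕ} {α : Type*} [LT α] (g : Fin m × Bool → α) : Prop :=
  (∀ k, g (k, false) < g (k, true)) ∧ ∀ i j, i < j → g (i, false) < g (j, false)

theorem exists_perm_bool_lt {α : Type*} [LinearOrder α] {f : Bool → α}
    (hf : Function.Injective f) :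
    ∃ ρ : Equiv.Perm Bool, f (ρ false) < f (ρ true) ∧
      ∀ ρ' : Equiv.Perm Bool, f (ρ' false) < f (ρ' true) → ρ' = ρ := by
  have key : ∀ ρ ρ' : Equiv.Perm Bool, ρ false = ρ' false → ρ = ρ' := by decide
  have hne : ∀ ρ : Equiv.Perm Bool, ρ true = !(ρ false) := by decide
  rcases lt_or_gt_of_ne (hf.ne Bool.false_ne_true) with h | h
  · refine ⟨1, h, fun ρ' h' => key _ _ ?_⟩
    rw [hne] at h'
    cases hb : ρ' false
    · rfl
    · rw [hb] at h'; exact absurd h' h.not_gt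
  · refine ⟨Equiv.swap false true, by simpa using h, fun ρ' h' => key _ _ ?_⟩
    rw [hne] at h'
    cases hb : ρ' false
    · rw [hb] at h'; exact absurd h' h.not_gt
    · simp

theorem existsUnique_isSortedPairing {m : ℕ} {α : Type*} [LinearOrder α]
    {g : Fin m × Bool → α} (hg : Function.Injective g) :
    ∃! h : Equiv.Perm (Fin m) × (Fin m → Equiv.Perm Bool),
      IsSortedPairing (g ∘ couplePerm h) := by
  choose ρ hρ hρu using fun k => exists_perm_bool_lt (f := fun b => g (k, b))
    (fun b c h => congrArg Prod.snd (hg h))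
  set μ : Fin m → α := fun k => g (k, ρ k false)
  have hμ : Function.Injective μ := fun i j h => congrArg Prod.fst (hg h)
  have hsort := Tuple.monotone_sort μ
  refine ⟨(Tuple.sort μ, fun k => ρ (Tuple.sort μ k)), ⟨fun k => hρ _, fun i j hij => ?_⟩, ?_⟩
  · exact hsort.strictMono_of_injective (hμ.comp (Tuple.sort μ).injective) hij
  · rintro ⟨π, ρ'⟩ ⟨h1, h2⟩
    have hρ' : ∀ k, ρ' k = ρ (π k) := fun k => hρu _ _ (h1 k)
    have hmono : StrictMono (μ ∘ π) := fun i j hij => by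
      have := h2 i j hij
      simp only [Function.comp_apply, couplePerm_apply, hρ'] at this
      exact this
    have hπ : π = Tuple.sort μ := by
      ext1 k
      exact hμ (congrFun (Tuple.unique_monotone hmono.monotone hsort) k)
    refine Prod.ext hπ (funext fun k => ?_)
    simp only [hρ', hπ]

/-- The signed product attached to a permutation in the Pfaffian of `M`. -/
def pfaffianTerm {R : Type*} [CommRing R] {m : ℕ} (M : Matrix (Fin m × Bool) (Fin m × Bool) R)
    (σ : Equiv.Perm (Fin m × Bool)) : R :=
  ((Equiv.Perm.sign σ : ℤ) : R) * ∏ k, M (σ (k, false)) (σ (k, true))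

theorem pfaffian_eq_sum_pairing {R : Type*} [CommRing R] (m : ℕ)
    (M : Matrix (Fin (2 * m)) (Fin (2 * m)) R) [∀ σ : Equiv.Perm (Fin m × Bool),
      Decidable (IsSortedPairing (pairEquiv m ∘ σ))] :
    pfaffian m M = ∑ σ : Equiv.Perm (Fin m × Bool),
      if IsSortedPairing (pairEquiv m ∘ σ) then
        pfaffianTerm (M.submatrix (pairEquiv m) (pairEquiv m)) σ else 0 := by
  rw [pfaffian, ← Equiv.sum_comp (pairEquiv m).permCongr]
  refine sum_congr rfl fun σ _ => ?_
  have hf : ∀ (k : ℕ) (hk : k < m) (h : 2 * k < 2 * m),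
      (pairEquiv m).permCongr σ ⟨2 * k, h⟩ = pairEquiv m (σ (⟨k, hk⟩, false)) := by
    intro k hk h
    rw [Equiv.permCongr_apply]
    congr 2
    rw [Equiv.symm_apply_eq]
    simp [pairEquiv]
  have ht : ∀ (k : ℕ) (hk : k < m) (h : 2 * k + 1 < 2 * m),
      (pairEquiv m).permCongr σ ⟨2 * k + 1, h⟩ = pairEquiv m (σ (⟨k, hk⟩, true)) := by
    intro k hk h
    rw [Equiv.permCongr_apply]
    congr 2
    rw [Equiv.symm_apply_eq]
    simp [pairEquiv]
  simp only [fun k : Fin m => hf k k.2, fun k : Fin m => ht k k.2, Equiv.Perm.sign_permCongr]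
  exact if_congr Iff.rfl rfl rfl

theorem pfaffianTerm_mul_couplePerm {R : Type*} [CommRing R] {m : ℕ}
    (M : Matrix (Fin m × Bool) (Fin m × Bool) R) (hM : ∀ i j, M j i = -M i j)
    (σ : Equiv.Perm (Fin m × Bool)) (h : Equiv.Perm (Fin m) × (Fin m → Equiv.Perm Bool)) :
    pfaffianTerm M (σ * couplePerm h) = pfaffianTerm M σ := by
  have hb : ∀ (ρ : Equiv.Perm Bool) (k : Fin m), M (σ (k, ρ false)) (σ (k, ρ true)) =
      ((Equiv.Perm.sign ρ : ℤ) : R) * M (σ (k, false)) (σ (k, true)) := by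
    intro ρ k
    have : ρ = 1 ∨ ρ = Equiv.swap false true := by revert ρ; decide
    rcases this with rfl | rfl
    · simp
    · simpa using hM _ _
  have hsq : ∀ ρ : Equiv.Perm Bool,
      ((Equiv.Perm.sign ρ : ℤ) : R) * ((Equiv.Perm.sign ρ : ℤ) : R) = 1 := by
    intro ρ
    rcases Int.units_eq_one_or (Equiv.Perm.sign ρ) with h | h <;> simp [h]
  simp only [pfaffianTerm, Equiv.Perm.coe_mul, Function.comp_apply, couplePerm_apply,
    Equiv.Perm.sign_mul, sign_couplePerm, hb, prod_mul_distrib]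
  rw [Equiv.prod_comp h.1 fun k => M (σ (k, false)) (σ (k, true))]
  push_cast
  calc _ = ((Equiv.Perm.sign σ : ℤ) : R) *
        (∏ k, ((Equiv.Perm.sign (h.2 k) : ℤ) : R) * ((Equiv.Perm.sign (h.2 k) : ℤ) : R)) *
        ∏ k, M (σ (k, false)) (σ (k, true)) := by rw [prod_mul_distrib]; ring
    _ = _ := by simp [hsq]

/-- For antisymmetric `M`, summing over all permutations counts every term of the Pfaffian as
many times as there are reorderings of the couples. -/
theorem card_mul_pfaffian {R : Type*} [CommRing R] (m : ℕ)
    (M : Matrix (Fin (2 * m)) (Fin (2 * m)) R) (hM : ∀ i j, M j i = -M i j) :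
    (Fintype.card (Equiv.Perm (Fin m) × (Fin m → Equiv.Perm Bool)) : R) * pfaffian m M =
      ∑ σ, pfaffianTerm (M.submatrix (pairEquiv m) (pairEquiv m)) σ := by
  classical
  set w := pfaffianTerm (M.submatrix (pairEquiv m) (pairEquiv m))
  have hw : ∀ σ h, w (σ * couplePerm h) = w σ :=
    pfaffianTerm_mul_couplePerm _ fun i j => hM _ _
  have hone : ∀ σ : Equiv.Perm (Fin m × Bool),
      (∑ h, if IsSortedPairing (pairEquiv m ∘ (σ * couplePerm h : Equiv.Perm _))
        then w σ else 0) = w σ := by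
    intro σ
    obtain ⟨h₀, h₁, h₂⟩ := existsUnique_isSortedPairing
      ((pairEquiv m).injective.comp σ.injective)
    exact (Fintype.sum_eq_single h₀ fun h hh => if_neg fun hs => hh (h₂ h hs)).trans (if_pos h₁)
  calc _ = ∑ h : Equiv.Perm (Fin m) × (Fin m → Equiv.Perm Bool), pfaffian m M := by
        rw [sum_const, card_univ, nsmul_eq_mul]
    _ = ∑ h, ∑ σ : Equiv.Perm (Fin m × Bool),
        if IsSortedPairing (pairEquiv m ∘ (σ * couplePerm h : Equiv.Perm _))
          then w σ else 0 := by
        refine sum_congr rfl fun h _ => ?_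
        rw [pfaffian_eq_sum_pairing, ← Equiv.sum_comp (Equiv.mulRight (couplePerm h))]
        simp only [Equiv.coe_mulRight]
        exact sum_congr rfl fun σ _ => by rw [← hw σ h]; rfl
    _ = _ := by
        rw [sum_comm]
        exact sum_congr rfl fun σ _ => hone σ

theorem sum_pfaffianTerm_sub_mul {R : Type*} [CommRing R] {m : ℕ} (a : Fin m × Bool → R)
    (c : Matrix (Fin m × Bool) (Fin m × Bool) R) (hc : ∀ i j, c j i = c i j) :
    ∑ σ, pfaffianTerm (Matrix.of fun i j => (a i - a j) * c i j) σ =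
      (Fintype.card (Fin m → Equiv.Perm Bool) : R) *
        ∑ σ, pfaffianTerm (Matrix.of fun i j => a i * c i j) σ := by
  have hexp : ∀ σ : Equiv.Perm (Fin m × Bool),
      pfaffianTerm (Matrix.of fun i j => (a i - a j) * c i j) σ =
        ∑ ρ : Fin m → Equiv.Perm Bool,
          pfaffianTerm (Matrix.of fun i j => a i * c i j) (σ * couplePerm (1, ρ)) := by
    intro σ
    have huniv : (univ : Finset (Equiv.Perm Bool)) = {1, Equiv.swap false true} := by decide
    have hk : ∀ k, (a (σ (k, false)) - a (σ (k, true))) * c (σ (k, false)) (σ (k, true)) =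
        ∑ ρ : Equiv.Perm Bool, ((Equiv.Perm.sign ρ : ℤ) : R) *
          (a (σ (k, ρ false)) * c (σ (k, ρ false)) (σ (k, ρ true))) := by
      intro k
      rw [huniv, sum_pair (by decide)]
      simp [hc (σ (k, false))]
      ring
    simp only [pfaffianTerm, Matrix.of_apply, hk, prod_univ_sum, Fintype.piFinset_univ, mul_sum,
      Equiv.Perm.sign_mul, sign_couplePerm, Equiv.Perm.coe_mul, Function.comp_apply,
      couplePerm_apply, prod_mul_distrib, Equiv.Perm.coe_one, id]
    refine sum_congr rfl fun ρ _ => ?_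
    push_cast
    ring
  simp only [hexp]
  rw [sum_comm, Fintype.card, ← nsmul_eq_mul, ← sum_const]
  refine sum_congr rfl fun ρ _ => ?_
  exact Equiv.sum_comp (Equiv.mulRight (couplePerm (1, ρ))) _

theorem card_mul_sum_pfaffianTerm_mul {R : Type*} [CommRing R] {m : ℕ} (a : Fin m × Bool → R)
    (c : Matrix (Fin m × Bool) (Fin m × Bool) R) :
    (Fintype.card (Equiv.Perm (Fin m)) : R) *
        ∑ σ, pfaffianTerm (Matrix.of fun i j => a i * c i j) σ =
      ∑ σ : Equiv.Perm (Fin m × Bool), ((Equiv.Perm.sign σ : ℤ) : R) * (∏ k, a (σ (k, false))) *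
        (Matrix.of fun k l : Fin m => c (σ (k, false)) (σ (l, true))).det := by
  set tp : Equiv.Perm (Fin m) → Equiv.Perm (Fin m × Bool) :=
    fun τ => Equiv.prodCongrLeft fun b => if b then τ else 1
  have hsign : ∀ τ, Equiv.Perm.sign (tp τ) = Equiv.Perm.sign τ := fun τ => by
    rw [Equiv.Perm.sign_prodCongrLeft]; simp
  rw [Fintype.card, ← nsmul_eq_mul, ← sum_const]
  calc _ = ∑ τ, ∑ σ, pfaffianTerm (Matrix.of fun i j => a i * c i j) (σ * tp τ) :=
        sum_congr rfl fun τ _ => (Equiv.sum_comp (Equiv.mulRight (tp τ)) _).symm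
    _ = _ := by
        rw [sum_comm]
        refine sum_congr rfl fun σ _ => ?_
        rw [← Matrix.det_transpose, Matrix.det_apply', mul_sum]
        refine sum_congr rfl fun τ _ => ?_
        have hf : ∀ k, tp τ (k, false) = (k, false) := fun k => by simp [tp]
        have ht : ∀ k, tp τ (k, true) = (τ k, true) := fun k => by simp [tp]
        simp only [pfaffianTerm, Equiv.Perm.sign_mul, hsign, Equiv.Perm.coe_mul,
          Function.comp_apply, hf, ht, Matrix.of_apply, Matrix.transpose_apply,
          prod_mul_distrib]
        push_cast
        ring

/-- Proportional minors give proportional Pfaffians. -/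
theorem pfaffian_sub_mul_eq_of_det_eq {K : Type*} [Field K] [CharZero K] (m : ℕ)
    (a : Fin (2 * m) → K) (c d : Matrix (Fin (2 * m)) (Fin (2 * m)) K)
    (hc : ∀ i j, c j i = c i j) (hd : ∀ i j, d j i = d i j) (κ : K)
    (h : ∀ e : Fin m × Bool ≃ Fin (2 * m),
      (Matrix.of fun k l : Fin m => d (e (k, false)) (e (l, true))).det =
        κ * (Matrix.of fun k l : Fin m => c (e (k, false)) (e (l, true))).det) :
    pfaffian m (Matrix.of fun i j => (a i - a j) * d i j) =
      κ * pfaffian m (Matrix.of fun i j => (a i - a j) * c i j) := by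
  have hexp : ∀ c : Matrix (Fin (2 * m)) (Fin (2 * m)) K, (∀ i j, c j i = c i j) →
      (Fintype.card (Equiv.Perm (Fin m)) : K) *
        ((Fintype.card (Equiv.Perm (Fin m) × (Fin m → Equiv.Perm Bool)) : K) *
          pfaffian m (Matrix.of fun i j => (a i - a j) * c i j)) =
      (Fintype.card (Fin m → Equiv.Perm Bool) : K) *
        ∑ σ : Equiv.Perm (Fin m × Bool), ((Equiv.Perm.sign σ : ℤ) : K) *
          (∏ k, a (pairEquiv m (σ (k, false)))) *
          (Matrix.of fun k l : Fin m =>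
            c (pairEquiv m (σ (k, false))) (pairEquiv m (σ (l, true)))).det := by
    intro c hc
    rw [card_mul_pfaffian _ _ fun i j => by simp only [Matrix.of_apply, hc i j]; ring]
    have h1 := sum_pfaffianTerm_sub_mul (fun p => a (pairEquiv m p))
      (c.submatrix (pairEquiv m) (pairEquiv m)) fun i j => hc _ _
    have h2 := card_mul_sum_pfaffianTerm_mul (fun p => a (pairEquiv m p))
      (c.submatrix (pairEquiv m) (pairEquiv m))
    simp only [Matrix.submatrix_apply] at h1 h2
    rw [← h2, mul_left_comm, ← h1]
    rfl
  have hne : (Fintype.card (Equiv.Perm (Fin m)) : K) *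
      (Fintype.card (Equiv.Perm (Fin m) × (Fin m → Equiv.Perm Bool)) : K) ≠ 0 :=
    mul_ne_zero (Nat.cast_ne_zero.2 Fintype.card_ne_zero)
      (Nat.cast_ne_zero.2 Fintype.card_ne_zero)
  refine mul_left_cancel₀ hne ?_
  rw [mul_assoc, hexp d hd, mul_left_comm, mul_assoc, hexp c hc, mul_left_comm κ, mul_sum _ _ κ]
  refine congrArg _ (sum_congr rfl fun σ _ => ?_)
  rw [show (Matrix.of fun k l : Fin m =>
      d (pairEquiv m (σ (k, false))) (pairEquiv m (σ (l, true)))).det = _ from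
      h (σ.trans (pairEquiv m))]
  simp only [Equiv.trans_apply]
  ring

/-- Exponents of the alternant numerator of the staircase Schur polynomial in `k + r + 2 * s`
variables, followed by the exponents that successively appear when two variables are added. -/
def stairExp (k r s j : ℕ) : ℕ :=
  if j < k + 2 * s then j
  else if j < k + r + 2 * s then 2 * j + 1 - (k + 2 * s)
  else if (j - (k + r)) % 2 = 0 then j - r else j + r

theorem padIncr_staircase_add (k r s : ℕ) (j : Fin (k + r + 2 * s)) :
    padIncr r (k + r + 2 * s) (staircase r) j + j = stairExp k r s j := by
  have hj := j.2
  simp only [padIncr, staircase, stairExp]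
  split_ifs <;> omega

theorem padIncr_staircase_add_zero (k r : ℕ) (j : Fin (k + r)) :
    padIncr r (k + r) (staircase r) j + j = stairExp k r 0 j :=
  padIncr_staircase_add k r 0 j

theorem exists_lt_stairExp_eq_add {k r : ℕ} (j l : ℕ) (hj : j < k + r) :
    ∃ i < k + r + 2 * l, stairExp k r 0 i = stairExp k r 0 j + 2 * l := by
  unfold stairExp
  by_cases h1 : j < k
  · by_cases h2 : j + 2 * l < k
    · exact ⟨j + 2 * l, by omega, by split_ifs <;> omega⟩
    · by_cases h3 : (j + 2 * l - k) % 2 = 0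
      · exact ⟨j + 2 * l + r, by omega, by split_ifs <;> omega⟩
      · by_cases h4 : (j + 2 * l - k) / 2 < r
        · exact ⟨k + (j + 2 * l - k) / 2, by omega, by split_ifs <;> omega⟩
        · exact ⟨j + 2 * l - r, by omega, by split_ifs <;> omega⟩
  · by_cases h4 : j + l < k + r
    · exact ⟨j + l, by omega, by split_ifs <;> omega⟩
    · exact ⟨2 * j + 1 + 2 * l - k - r, by omega, by split_ifs <;> omega⟩

theorem det_pow_stairExp_succ {R : Type*} [CommRing R] {p : ℕ} (k r s : ℕ)
    (hp : k + r + 2 * s < p) (t : Fin p → R) :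
    (Matrix.of fun i j : Fin p => t i ^ stairExp k r (s + 1) j).det =
      (-1) ^ r * (Matrix.of fun i j : Fin p => t i ^ stairExp k r s j).det := by
  have : NeZero p := ⟨by omega⟩
  set a : Fin p := ⟨k + 2 * s, by omega⟩
  set b : Fin p := ⟨k + r + 2 * s, hp⟩
  have hab : a ≤ b := Fin.mk_le_mk.2 (by omega)
  have hcol : ∀ j : Fin p, stairExp k r s j = stairExp k r (s + 1) (Fin.cycleIcc a b j) := by
    intro j
    rcases lt_or_ge j a with h | h
    · rw [Fin.cycleIcc_of_lt h]
      have h' : (j : ℕ) < k + 2 * s := h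
      unfold stairExp
      split_ifs <;> omega
    rcases lt_or_ge b j with h2 | h2
    · rw [Fin.cycleIcc_of_gt h2]
      have h' : k + r + 2 * s < (j : ℕ) := h2
      unfold stairExp
      split_ifs <;> omega
    rcases h2.lt_or_eq with h2 | rfl
    · rw [Fin.cycleIcc_of_ge_of_lt h h2]
      have h' : k + 2 * s ≤ (j : ℕ) := h
      have h2' : (j : ℕ) < k + r + 2 * s := h2
      rw [Fin.val_add_one_of_lt' (by omega)]
      unfold stairExp
      split_ifs <;> omega
    · rw [Fin.cycleIcc_of_last hab]
      simp only [a, b]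
      unfold stairExp
      split_ifs <;> omega
  have hM : (Matrix.of fun i j : Fin p => t i ^ stairExp k r s j) =
      (Matrix.of fun i j : Fin p => t i ^ stairExp k r (s + 1) j).submatrix id
        (Fin.cycleIcc a b) := by
    ext i j
    simp [hcol]
  have hr : (b : ℕ) - a = r := by simp only [a, b]; omega
  rw [hM, Matrix.det_permute', Fin.sign_cycleIcc_of_le hab, hr, ← mul_assoc]
  push_cast
  rw [← mul_pow]
  simp

theorem det_pow_stairExp {R : Type*} [CommRing R] {p : ℕ} (k r s : ℕ)
    (hp : k + r + 2 * s ≤ p) (t : Fin p → R) :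
    (Matrix.of fun i j : Fin p => t i ^ stairExp k r s j).det =
      (-1) ^ (r * s) * (Matrix.of fun i j : Fin p => t i ^ stairExp k r 0 j).det := by
  induction s with
  | zero => simp
  | succ s ih => rw [det_pow_stairExp_succ k r s (by omega), ih (by omega)]; ring

/-- Column reduction of the alternant: the powers beyond the first `k + r` exponents may be
replaced by `t ^ (2 * l)` times fixed functions. -/
theorem det_pow_stairExp_eq_reduced {R : Type*} [CommRing R] {p : ℕ} (k r : ℕ)
    (t : Fin p → R) (α : ℕ → Fin (k + r) → R) :
    (Matrix.of fun i j : Fin p => t i ^ stairExp k r 0 j).det =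
      (Matrix.of fun i j : Fin p => if (j : ℕ) < k + r then t i ^ stairExp k r 0 j else
        t i ^ (2 * ((j - (k + r)) / 2)) * (t i ^ stairExp k r 0 (k + r + (j - (k + r)) % 2) -
          ∑ a : Fin (k + r), α ((j - (k + r)) % 2) a * t i ^ stairExp k r 0 a)).det := by
  choose φ hφlt hφ using fun (a : Fin (k + r)) (l : ℕ) =>
    exists_lt_stairExp_eq_add (a : ℕ) l a.2
  set T : Matrix (Fin p) (Fin p) R := 1 - Matrix.of fun i j : Fin p =>
    if (j : ℕ) < k + r then 0 else ∑ a : Fin (k + r),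
      if (i : ℕ) = φ a ((j - (k + r)) / 2) then α ((j - (k + r)) % 2) a else 0 with hT
  have hzero : ∀ i j : Fin p, j ≤ i → (if (j : ℕ) < k + r then (0 : R) else
      ∑ a : Fin (k + r), if (i : ℕ) = φ a ((j - (k + r)) / 2)
        then α ((j - (k + r)) % 2) a else 0) = 0 := by
    intro i j hij
    have hij' : (j : ℕ) ≤ i := hij
    split_ifs with h
    · rfl
    · refine sum_eq_zero fun a _ => if_neg fun hia => ?_
      have := hφlt a ((j - (k + r)) / 2)
      omega
  have hdet : T.det = 1 := by
    rw [Matrix.det_of_isUpperTriangular]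
    · simp [hT, hzero]
    · intro i j hij
      have hij' : j < i := hij
      simp only [hT, Matrix.sub_apply, Matrix.of_apply, Matrix.one_apply_ne hij'.ne',
        hzero i j hij'.le, sub_zero]
  rw [← mul_one (Matrix.det _), ← hdet, ← Matrix.det_mul]
  congr 1
  ext i j
  have hj := j.2
  rw [hT, Matrix.mul_sub, Matrix.mul_one, Matrix.sub_apply, Matrix.mul_apply]
  simp only [Matrix.of_apply]
  split_ifs with h
  · simp
  · have he : stairExp k r 0 j = 2 * ((j - (k + r)) / 2) +
        stairExp k r 0 (k + r + (j - (k + r)) % 2) := by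
      unfold stairExp
      split_ifs <;> omega
    rw [mul_sub, ← pow_add, ← he, mul_sum]
    congr 1
    simp only [mul_sum]
    rw [sum_comm]
    refine sum_congr rfl fun a _ => ?_
    have hlt := hφlt a ((j - (k + r)) / 2)
    have hlt' : φ a ((j - (k + r)) / 2) < p := by omega
    rw [sum_eq_single ⟨φ a ((j - (k + r)) / 2), hlt'⟩]
    · simp only [if_true, hφ]
      ring
    · intro i' _ hi'
      rw [if_neg fun h => hi' (Fin.ext h), mul_zero]
    · simp

/-- The `2 * m`-square matrix with rows `(u i, v i, q i * u i, q i * v i, …)`. -/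
def interleavedVandermonde {R : Type*} [CommRing R] (m : ℕ) (q u v : Fin (2 * m) → R) :
    Matrix (Fin (2 * m)) (Fin (2 * m)) R :=
  Matrix.of fun i j => q i ^ ((j : ℕ) / 2) * if (j : ℕ) % 2 = 0 then u i else v i

theorem exists_det_append_stairExp {K : Type*} [Field K] (k r : ℕ) (y : Fin (k + r) → K)
    (hy : (Matrix.of fun i j : Fin (k + r) => y i ^ stairExp k r 0 j).det ≠ 0) :
    ∃ u v : K → K, ∀ (m : ℕ) (x : Fin (2 * m) → K),
      (Matrix.of fun i j : Fin (k + r + 2 * m) =>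
        Fin.append y x i ^ stairExp k r m j).det =
      (-1) ^ (r * m) * (Matrix.of fun i j : Fin (k + r) => y i ^ stairExp k r 0 j).det *
        (interleavedVandermonde m (fun i => x i ^ 2) (fun i => u (x i))
          (fun i => v (x i))).det := by
  set A := Matrix.of fun i j : Fin (k + r) => y i ^ stairExp k r 0 j with hA
  set α : ℕ → Fin (k + r) → K :=
    fun b => A⁻¹.mulVec fun i => y i ^ stairExp k r 0 (k + r + b)
  have hα : ∀ b i, ∑ a, α b a * y i ^ stairExp k r 0 a = y i ^ stairExp k r 0 (k + r + b) := by
    intro b i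
    have h : A.mulVec (α b) = fun i => y i ^ stairExp k r 0 (k + r + b) := by
      rw [Matrix.mulVec_mulVec, Matrix.mul_nonsing_inv _ (isUnit_iff_ne_zero.2 hy),
        Matrix.one_mulVec]
    rw [← congrFun h i]
    exact sum_congr rfl fun a _ => mul_comm _ _
  set f : ℕ → K → K := fun b t =>
    t ^ stairExp k r 0 (k + r + b) - ∑ a : Fin (k + r), α b a * t ^ stairExp k r 0 a
  refine ⟨f 0, f 1, fun m x => ?_⟩
  rw [det_pow_stairExp k r m le_rfl, det_pow_stairExp_eq_reduced k r _ α,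
    ← Matrix.det_submatrix_equiv_self finSumFinEquiv, mul_assoc]
  refine congrArg _ ?_
  rw [← Matrix.det_fromBlocks_zero₁₂ A
    (Matrix.of fun i (j : Fin (k + r)) => x i ^ stairExp k r 0 j)]
  refine congrArg _ ?_
  ext (i | i) (j | j)
  · simp only [Matrix.submatrix_apply, finSumFinEquiv_apply_left, Matrix.of_apply,
      Fin.append_left, Fin.val_castAdd, j.2, if_true, Matrix.fromBlocks_apply₁₁, hA]
  · simp [hα]
  · simp
  · rcases Nat.mod_two_eq_zero_or_one j with h | h <;>
      simp [interleavedVandermonde, h, f, pow_mul]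

theorem det_append_pow {R : Type*} [CommRing R] [Nontrivial R] {N M : ℕ} (y : Fin N → R)
    (x : Fin M → R) :
    (Matrix.of fun i j : Fin (N + M) => Fin.append y x i ^ (j : ℕ)).det =
      (Matrix.of fun i j : Fin N => y i ^ (j : ℕ)).det * (∏ i, ∏ l, (x i - y l)) *
        (Matrix.of fun i j : Fin M => x i ^ (j : ℕ)).det := by
  set Q := Lagrange.nodal univ y
  set P : Fin (N + M) → Polynomial R := Fin.append (fun j : Fin N => Polynomial.X ^ (j : ℕ))
    (fun j : Fin M => Polynomial.X ^ (j : ℕ) * Q)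
  have hQ : Q.Monic := Lagrange.nodal_monic
  have hP : ∀ j, (P j).Monic ∧ (P j).natDegree = j := by
    refine Fin.addCases (fun j => ?_) fun j => ?_
    · simp only [P, Fin.append_left]
      exact ⟨Polynomial.monic_X_pow _, by simp⟩
    · simp only [P, Fin.append_right]
      refine ⟨(Polynomial.monic_X_pow _).mul hQ, ?_⟩
      rw [(Polynomial.monic_X_pow _).natDegree_mul hQ, Lagrange.natDegree_nodal]
      simp [add_comm]
  have h := Matrix.det_eval_matrixOfPolynomials_eq_det_vandermonde (Fin.append y x) P
    (fun j => (hP j).2) (fun j => (hP j).1)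
  rw [← Matrix.det_submatrix_equiv_self finSumFinEquiv (Matrix.of _)] at h
  have hblock : Matrix.submatrix (Matrix.of fun i j => (P j).eval (Fin.append y x i))
      (finSumFinEquiv (m := N) (n := M)) finSumFinEquiv =
      Matrix.fromBlocks (Matrix.of fun i j : Fin N => y i ^ (j : ℕ)) 0
        (Matrix.of fun i (j : Fin N) => x i ^ (j : ℕ))
        (Matrix.of fun i j : Fin M => (∏ l, (x i - y l)) * x i ^ (j : ℕ)) := by
    ext (i | i) (j | j)
    · simp [P]
    · simp [P, Q, Lagrange.eval_nodal_at_node]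
    · simp [P]
    · simp [P, Q, Lagrange.eval_nodal, mul_comm]
  rw [hblock, Matrix.det_fromBlocks_zero₁₂] at h
  have hcol := Matrix.det_mul_column (fun i => ∏ l, (x i - y l))
    (Matrix.of fun i j : Fin M => x i ^ (j : ℕ))
  simp only [Matrix.of_apply] at hcol
  rw [hcol, ← mul_assoc] at h
  exact h

/-- The even positions of `Fin (2 * m)` followed by the odd ones. -/
def evenOddEquiv (m : ℕ) : Fin m ⊕ Fin m ≃ Fin (2 * m) :=
  (Equiv.boolProdEquivSum (Fin m)).symm.trans ((Equiv.prodComm _ _).trans (pairEquiv m))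

theorem det_pairVandermonde_comp {K : Type*} [Field K] (m : ℕ) (q u v : Fin (2 * m) → K)
    (e : Fin m ⊕ Fin m ≃ Fin (2 * m)) :
    (pairVandermonde m (q ∘ e) (u ∘ e) (v ∘ e)).det =
      ((Equiv.Perm.sign (e.trans (evenOddEquiv m).symm) : ℤ) : K) *
        (interleavedVandermonde m q u v).det := by
  have h : pairVandermonde m (q ∘ e) (u ∘ e) (v ∘ e) =
      ((interleavedVandermonde m q u v).submatrix (evenOddEquiv m) (evenOddEquiv m)).submatrix
        (e.trans (evenOddEquiv m).symm) id := by
    have h0 : ∀ j : Fin m, (evenOddEquiv m (.inl j) : ℕ) = 2 * j := fun j => by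
      simp [evenOddEquiv, pairEquiv]
    have h1 : ∀ j : Fin m, (evenOddEquiv m (.inr j) : ℕ) = 2 * j + 1 := fun j => by
      simp [evenOddEquiv, pairEquiv]
    ext i (j | j)
    · have hdiv : (2 * (j : ℕ)) / 2 = j := by omega
      simp [pairVandermonde, interleavedVandermonde, h0, hdiv]
      exact mul_comm _ _
    · have hdiv : (2 * (j : ℕ) + 1) / 2 = j := by omega
      simp [pairVandermonde, interleavedVandermonde, h1, hdiv]
      exact mul_comm _ _
  rw [h, Matrix.det_permute, Matrix.det_submatrix_equiv_self]

theorem det_interleavedVandermonde_sq {R : Type*} [CommRing R] (m : ℕ) (x : Fin (2 * m) → R) :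
    (interleavedVandermonde m (fun i => x i ^ 2) 1 x).det =
      (Matrix.of fun i j : Fin (2 * m) => x i ^ (j : ℕ)).det := by
  congr 1
  ext i j
  simp only [interleavedVandermonde, Matrix.of_apply, ← pow_mul, Pi.one_apply]
  rcases Nat.mod_two_eq_zero_or_one j with h | h
  · rw [if_pos h, mul_one, show 2 * ((j : ℕ) / 2) = j by omega]
  · rw [if_neg (by omega), ← pow_succ, show 2 * ((j : ℕ) / 2) + 1 = j by omega]

theorem det_interleavedVandermonde_mul {R : Type*} [CommRing R] (m : ℕ)
    (q w u v : Fin (2 * m) → R) :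
    (interleavedVandermonde m q (w * u) (w * v)).det =
      (∏ i, w i) * (interleavedVandermonde m q u v).det := by
  rw [← Matrix.det_mul_column]
  congr 1
  ext i j
  simp only [interleavedVandermonde, Matrix.of_apply, Pi.mul_apply]
  split_ifs <;> ring

theorem exists_schur_staircase_append {K : Type*} [Field K] (k r : ℕ) (y : Fin (k + r) → K)
    (hy : (Matrix.of fun i j : Fin (k + r) => y i ^ stairExp k r 0 j).det ≠ 0) :
    ∃ u v : K → K, ∀ (m : ℕ) (x : Fin (2 * m) → K),
      schur (padIncr r (k + r + 2 * m) (staircase r)) (Fin.append y x) =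
        (-1) ^ (r * m) * schur (padIncr r (k + r) (staircase r)) y *
          ((interleavedVandermonde m (fun i => x i ^ 2) (fun i => u (x i))
            (fun i => v (x i))).det / (Matrix.of fun i j : Fin (2 * m) => x i ^ (j : ℕ)).det) := by
  obtain ⟨u, v, huv⟩ := exists_det_append_stairExp k r y hy
  refine ⟨fun t => (∏ l, (t - y l))⁻¹ * u t, fun t => (∏ l, (t - y l))⁻¹ * v t,
    fun m x => ?_⟩
  have hrow := det_interleavedVandermonde_mul m (fun i => x i ^ 2)
    (fun i => (∏ l, (x i - y l))⁻¹) (fun i => u (x i)) (fun i => v (x i))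
  simp only [Pi.mul_def] at hrow
  simp only [schur, padIncr_staircase_add, padIncr_staircase_add_zero, huv, det_append_pow,
    hrow, prod_inv_distrib, div_eq_mul_inv, mul_inv]
  ring

/-- The Pfaffian factorization over an arbitrary field of characteristic zero. -/
theorem pfaffian_staircase_schur_of_field {K : Type*} [Field K] [CharZero K] {k r m : ℕ}
    (hm : 1 ≤ m) (a x : Fin (2 * m) → K) (y : Fin (k + r) → K)
    (hy : (Matrix.of fun i j : Fin (k + r) => y i ^ stairExp k r 0 j).det ≠ 0)
    (hx : Function.Injective x) (hxx : ∀ i j, x i + x j ≠ 0) :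
    pfaffian m (Matrix.of fun i j : Fin (2 * m) => (a i - a j) / (x i + x j) *
        schur (padIncr r (k + r + 2) (staircase r)) (Fin.append y ![x i, x j])) =
      schur (padIncr r (k + r) (staircase r)) y ^ (m - 1) *
        schur (padIncr r (k + r + 2 * m) (staircase r)) (Fin.append y x) *
        pfaffian m (Matrix.of fun i j : Fin (2 * m) => (a i - a j) / (x i + x j)) := by
  obtain ⟨u, v, huv⟩ := exists_schur_staircase_append k r y hy
  set S := schur (padIncr r (k + r) (staircase r)) y
  set q : Fin (2 * m) → K := fun i => x i ^ 2
  have hsub : ∀ i j, i ≠ j → x j - x i ≠ 0 := fun i j hij => sub_ne_zero.2 (hx.ne hij.symm)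
  have hq : Function.Injective q := fun i j hij => by
    by_contra hne
    have : (x j - x i) * (x i + x j) = 0 := by
      have : x i ^ 2 = x j ^ 2 := hij
      linear_combination -this
    exact mul_ne_zero (hsub i j hne) (hxx i j) this
  have hpair : ∀ i j, i ≠ j →
      schur (padIncr r (k + r + 2) (staircase r)) (Fin.append y ![x i, x j]) / (x i + x j) =
        (-1) ^ r * S * ((u (x i) * v (x j) - v (x i) * u (x j)) / (q j - q i)) := by
    intro i j hij
    have h : schur (padIncr r (k + r + 2) (staircase r)) (Fin.append y ![x i, x j]) = _ :=
      huv 1 ![x i, x j]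
    have hqq : q j - q i = (x j - x i) * (x i + x j) := by simp only [q]; ring
    rw [h, Matrix.det_fin_two, Matrix.det_fin_two, hqq]
    simp only [interleavedVandermonde, Matrix.of_apply]
    simp
    have := hsub i j hij
    have := hxx i j
    field_simp
  have hF1 : (Matrix.of fun i j : Fin (2 * m) => x i ^ (j : ℕ)).det ≠ 0 :=
    Matrix.det_vandermonde_ne_zero_iff.2 hx
  have hmain := pfaffian_sub_mul_eq_of_det_eq m a (Matrix.of fun i j => (x i + x j)⁻¹)
    (Matrix.of fun i j =>
      schur (padIncr r (k + r + 2) (staircase r)) (Fin.append y ![x i, x j]) / (x i + x j))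
    (fun i j => by simp only [Matrix.of_apply, add_comm])
    (fun i j => by
      rcases eq_or_ne i j with rfl | hij
      · rfl
      · simp only [Matrix.of_apply]
        rw [hpair i j hij, hpair j i hij.symm, ← neg_sub (q i), div_neg, ← neg_div]
        ring)
    (S ^ (m - 1) * schur (padIncr r (k + r + 2 * m) (staircase r)) (Fin.append y x)) ?_
  · convert hmain using 3
    all_goals
      ext i j
      simp only [Matrix.of_apply]
      ring
  · intro e
    set e' : Fin m ⊕ Fin m ≃ Fin (2 * m) :=
      (Equiv.boolProdEquivSum (Fin m)).symm.trans ((Equiv.prodComm _ _).trans e)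
    have hl : ∀ i, e' (.inl i) = e (i, false) := fun i => rfl
    have hr : ∀ i, e' (.inr i) = e (i, true) := fun i => rfl
    have hne : ∀ i j, e (i, false) ≠ e (j, true) := fun i j h => by simpa using e.injective h
    obtain ⟨κ, hκ⟩ := exists_det_loewner_mul_eq (q ∘ e') (hq.comp e'.injective)
    have hU := hκ ((fun i => u (x i)) ∘ e') ((fun i => v (x i)) ∘ e')
    have h1 := hκ ((1 : Fin (2 * m) → K) ∘ e') (x ∘ e')
    rw [det_pairVandermonde_comp] at hU h1
    rw [det_interleavedVandermonde_sq] at h1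
    simp only [Function.comp_apply, hl, hr, Pi.one_apply, one_mul, mul_one] at hU h1
    have hc : (Matrix.of fun i j : Fin m => (x (e (j, true)) - x (e (i, false))) /
        (q (e (j, true)) - q (e (i, false)))) =
        Matrix.of fun i j => (x (e (i, false)) + x (e (j, true)))⁻¹ := by
      ext i j
      have hqq : q (e (j, true)) - q (e (i, false)) = (x (e (j, true)) - x (e (i, false))) *
        (x (e (i, false)) + x (e (j, true))) := by simp only [q]; ring
      rw [Matrix.of_apply, Matrix.of_apply, hqq, div_mul_cancel_left₀ (hsub _ _ (hne i j))]
    have hd : (Matrix.of fun i j : Fin m => schur (padIncr r (k + r + 2) (staircase r))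
          (Fin.append y ![x (e (i, false)), x (e (j, true))]) /
          (x (e (i, false)) + x (e (j, true)))) =
        ((-1) ^ r * S) • Matrix.of fun i j =>
          (u (x (e (i, false))) * v (x (e (j, true))) - v (x (e (i, false))) *
            u (x (e (j, true)))) / (q (e (j, true)) - q (e (i, false))) := by
      ext i j
      simp only [Matrix.of_apply, Matrix.smul_apply, smul_eq_mul, hpair _ _ (hne i j)]
    rw [hc] at h1
    simp only [Matrix.of_apply]
    rw [hd, Matrix.det_smul, Fintype.card_fin, huv m x]
    set sg : K := ((Equiv.Perm.sign (e'.trans (evenOddEquiv m).symm) : ℤ) : K)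
    have hsg : sg ≠ 0 := by
      rcases Int.units_eq_one_or (Equiv.Perm.sign (e'.trans (evenOddEquiv m).symm)) with h | h <;>
        simp [sg, h]
    have hκ0 : κ ≠ 0 := by
      rintro rfl
      rw [mul_zero] at h1
      exact mul_ne_zero hsg hF1 h1.symm
    set F1 := (Matrix.of fun i j : Fin (2 * m) => x i ^ (j : ℕ)).det
    set F := (interleavedVandermonde m (fun i => x i ^ 2) (fun i => u (x i))
      (fun i => v (x i))).det
    set dc := (Matrix.of fun i j : Fin m => (x (e (i, false)) + x (e (j, true)))⁻¹).det
    set dd := (Matrix.of fun i j : Fin m =>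
      (u (x (e (i, false))) * v (x (e (j, true))) - v (x (e (i, false))) *
        u (x (e (j, true)))) / (q (e (j, true)) - q (e (i, false)))).det
    have hkey : dd * F1 = F * dc :=
      mul_left_cancel₀ (mul_ne_zero hsg hκ0) (by linear_combination sg * F1 * hU - sg * F * h1)
    have hS : S ^ m = S ^ (m - 1) * S := by rw [← pow_succ, Nat.sub_add_cancel hm]
    rw [mul_pow, hS, ← pow_mul]
    field_simp
    linear_combination S * S ^ (m - 1) * hkey

theorem det_X_pow_ne_zero {σ R : Type*} [CommRing R] [CharZero R] {N : ℕ}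
    (g : Fin N → σ) (hg : Function.Injective g) (e : Fin N → ℕ) (he : Function.Injective e) :
    (Matrix.of fun i j : Fin N => (MvPolynomial.X (g i) : MvPolynomial σ R) ^ e j).det ≠ 0 := by
  classical
  intro h
  have h0 := congrArg (MvPolynomial.eval
    (fun s => if hs : ∃ i, g i = s then (2 : R) ^ (hs.choose : ℕ) else 0)) h
  have hev : ∀ i, (if hs : ∃ j, g j = g i then (2 : R) ^ (hs.choose : ℕ) else 0) =
      2 ^ (i : ℕ) := fun i => by
    have hs : ∃ j, g j = g i := ⟨i, rfl⟩
    rw [dif_pos hs, hg hs.choose_spec]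
  rw [RingHom.map_det, map_zero] at h0
  have hN : ((Matrix.vandermonde fun j : Fin N => (2 : ℤ) ^ e j).det : R) = 0 := by
    rw [← eq_intCast (Int.castRingHom R), RingHom.map_det, ← Matrix.det_transpose]
    rw [← h0]
    congr 1
    ext i j
    simp only [Matrix.transpose_apply, RingHom.mapMatrix_apply, Matrix.map_apply,
      Matrix.vandermonde_apply, Matrix.of_apply, map_pow, MvPolynomial.eval_X, hev]
    simp [← pow_mul, mul_comm]
  refine Matrix.det_vandermonde_ne_zero_iff.2 ?_ (Int.cast_eq_zero.1 hN)
  exact fun i j hij => he (pow_right_injective₀ (by norm_num) (by norm_num) hij)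

theorem stairExp_zero_injective (k r : ℕ) :
    Function.Injective fun j : Fin (k + r) => stairExp k r 0 j := by
  intro i j h
  simp only [stairExp] at h
  ext
  split_ifs at h <;> omega

theorem algebraMap_fractionRing_injective {R : Type*} [CommRing R] [IsDomain R] :
    Function.Injective (algebraMap R (FractionRing R)) :=
  IsFractionRing.injective _ _
/-- Factorization of the Pfaffian with staircase Schur function entries:
`Pf( (aᵢ-aⱼ)/(xᵢ+xⱼ) · s_ρ(y, xᵢ, xⱼ) )
  = (s_ρ(y))^{m-1} · s_ρ(y, x₁,…,x_n) · Pf( (aᵢ-aⱼ)/(xᵢ+xⱼ) )`. -/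
theorem pfaffian_staircase_schur (N m r : ℕ) (hm : 1 ≤ m) (hr : 1 ≤ r) (hrN : r ≤ N) :
    pfaffian m (Matrix.of fun i j : Fin (2 * m) =>
        (A15 N (2 * m) i - A15 N (2 * m) j) / (X15 N (2 * m) i + X15 N (2 * m) j) *
          schur (padIncr r (N + 2) (staircase r))
            (fun q : Fin (N + 2) =>
              if h : (q : ℕ) < N then Y15 N (2 * m) ⟨q, h⟩
              else if (q : ℕ) = N then X15 N (2 * m) i else X15 N (2 * m) j))
      = schur (padIncr r N (staircase r)) (Y15 N (2 * m)) ^ (m - 1) *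
          schur (padIncr r (N + 2 * m) (staircase r))
            (fun q : Fin (N + 2 * m) =>
              if h : (q : ℕ) < N then Y15 N (2 * m) ⟨q, h⟩
              else X15 N (2 * m) ⟨(q : ℕ) - N, by omega⟩) *
          pfaffian m (Matrix.of fun i j : Fin (2 * m) =>
            (A15 N (2 * m) i - A15 N (2 * m) j) / (X15 N (2 * m) i + X15 N (2 * m) j)) := by
  obtain ⟨k, rfl⟩ : ∃ k, N = k + r := ⟨N - r, by omega⟩
  have hinj := algebraMap_fractionRing_injective
    (R := MvPolynomial (Fin (2 * m) ⊕ Fin (k + r) ⊕ Fin (2 * m)) ℚ)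
  have hy : (Matrix.of fun i j : Fin (k + r) =>
      Y15 (k + r) (2 * m) i ^ stairExp k r 0 j).det ≠ 0 := by
    have h := (map_ne_zero_iff _ hinj).2 (det_X_pow_ne_zero (R := ℚ)
      (fun i : Fin (k + r) => (Sum.inr (Sum.inl i) : Fin (2 * m) ⊕ Fin (k + r) ⊕ Fin (2 * m)))
      (Sum.inr_injective.comp Sum.inl_injective) _ (stairExp_zero_injective k r))
    rw [RingHom.map_det] at h
    convert h using 2
    ext i j
    simp [Y15]
  have hx : Function.Injective (X15 (k + r) (2 * m)) := fun i j h => by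
    exact Sum.inr_injective (Sum.inr_injective (MvPolynomial.X_injective (hinj h)))
  have hxx : ∀ i j, X15 (k + r) (2 * m) i + X15 (k + r) (2 * m) j ≠ 0 := by
    intro i j h
    rw [X15, X15, ← map_add, map_eq_zero_iff _ hinj] at h
    have h1 := congrArg (MvPolynomial.eval fun _ => (1 : ℚ)) h
    norm_num at h1
  have hpair : ∀ i j : Fin (2 * m), (fun q : Fin (k + r + 2) =>
      if h : (q : ℕ) < k + r then Y15 (k + r) (2 * m) ⟨q, h⟩
      else if (q : ℕ) = k + r then X15 (k + r) (2 * m) i else X15 (k + r) (2 * m) j) =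
      Fin.append (Y15 (k + r) (2 * m)) ![X15 (k + r) (2 * m) i, X15 (k + r) (2 * m) j] := by
    intro i j
    refine funext (Fin.addCases (fun l => ?_) fun l => ?_)
    · rw [Fin.append_left, dif_pos (by simp)]
      rfl
    · rw [Fin.append_right, dif_neg (by simp)]
      fin_cases l <;> simp
  have hall : (fun q : Fin (k + r + 2 * m) =>
      if h : (q : ℕ) < k + r then Y15 (k + r) (2 * m) ⟨q, h⟩
      else X15 (k + r) (2 * m) ⟨(q : ℕ) - (k + r), by omega⟩) =
      Fin.append (Y15 (k + r) (2 * m)) (X15 (k + r) (2 * m)) := by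
    refine funext (Fin.addCases (fun l => ?_) fun l => ?_)
    · rw [Fin.append_left, dif_pos (by simp)]
      rfl
    · rw [Fin.append_right, dif_neg (by simp)]
      simp
  simp only [hpair, hall]
  exact pfaffian_staircase_schur_of_field hm _ _ _ hy hx hxx
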